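/- Let {A_i, i ≥ 1} be i.i.d. nonnegative random variables with 0 < μ := 1/E[A_1] < ∞, and let A_o(t) = max{n ≥ 0 : ∑_{i=1}^n A_i ≤ t}. Suppose that for some fixed constants C_3 > 0 and r_3 > s_3 > 1, for all integers k ≥ 1, E[|k − μ ∑_{i=1}^k A_i|^{r_3}] ≤ C_3 k^{s_3}. Then for all ν > 0 and λ > 0, P(sup_{t ≥ 0}(A_o(t) − μ t − ν t) ≥ λ) ≤ (10^3 (r_3+1)^2 / ((s_3−1)(r_3−s_3)))^{r_3+1} C_3 ν^{−s_3} (μ + ν)^{r_3} μ^{−(r_3−s_3)} λ^{−(r_3−s_3)}. -/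

import Mathlib

open MeasureTheory ProbabilityTheory
open scoped NNReal ENNReal

/-- The number of renewals in `[0, t]` of a renewal process whose successive renewal
intervals are `ξ 0, ξ 1, ξ 2, ...`. -/
noncomputable def renewalCount (ξ : ℕ → ℝ) (t : ℝ) : ℕ :=
  sSup {n : ℕ | ∑ i ∈ Finset.range n, ξ i ≤ t}

lemma renewal_maximal {Ω : Type*} [MeasurableSpace Ω] (μ : Measure Ω) [IsProbabilityMeasure μ]
    (X : ℕ → Ω → ℝ) (hX : ∀ i, Measurable (X i)) (hind : iIndepFun X μ)
    (hint : ∀ i, Integrable (X i) μ) (hmean : ∀ i, ∫ ω, X i ω ∂μ = 0)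
    (C s r : ℝ) (hC : 0 < C) (hr : 1 ≤ r)
    (hmom : ∀ k : ℕ, 1 ≤ k →
      ∫⁻ ω, ENNReal.ofReal (|∑ i ∈ Finset.range k, X i ω| ^ r) ∂μ
        ≤ ENNReal.ofReal (C * (k : ℝ) ^ s)) (n : ℕ) (x : ℝ) (hx : 0 < x) :
    μ {ω | ∃ k, 1 ≤ k ∧ k ≤ n + 1 ∧ x ≤ ∑ i ∈ Finset.range k, X i ω} ≤
      ENNReal.ofReal (C * ((n + 1 : ℕ) : ℝ) ^ s / x ^ r) := by
  have hsm : ∀ i, StronglyMeasurable (X i) := fun i => (hX i).stronglyMeasurable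
  let 𝒢 := Filtration.natural X hsm
  let M : ℕ → Ω → ℝ := fun n ω => ∑ i ∈ Finset.range (n + 1), X i ω
  have hMint : ∀ n, Integrable (M n) μ := fun n => integrable_finsetSum _ fun i _ => hint i
  have hMad : StronglyAdapted 𝒢 M := by
    intro n
    refine Finset.stronglyMeasurable_fun_sum _ fun i hi => ?_
    exact (Filtration.stronglyAdapted_natural hsm i).mono
      (𝒢.mono (Nat.lt_succ_iff.mp (Finset.mem_range.mp hi)))
  have hM : Martingale M 𝒢 μ := by
    refine martingale_of_condExp_sub_eq_zero_nat hMad hMint fun i => ?_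
    have : M (i + 1) - M i = X (i + 1) := by
      ext ω
      simp [M, Finset.sum_range_succ _ (i + 1)]
    rw [this]
    refine (hind.condExp_natural_ae_eq_of_lt hsm (Nat.lt_succ_self i)).trans ?_
    filter_upwards with ω
    exact hmean (i + 1)
  let φ : ℝ → ℝ := fun y => |y| ^ r
  have hφc : ConvexOn ℝ Set.univ φ := by
    have h1 : ConvexOn ℝ Set.univ (fun y : ℝ => |y|) := convexOn_norm convex_univ
    refine ConvexOn.comp (g := fun x : ℝ => x ^ r) ((convexOn_rpow hr).subset ?_ ?_) h1 ?_
    · rintro _ ⟨y, -, rfl⟩; exact abs_nonneg y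
    · have : (fun y : ℝ => |y|) '' Set.univ = Set.Ici 0 := by
        ext z; constructor
        · rintro ⟨y, -, rfl⟩; exact abs_nonneg y
        · intro hz; exact ⟨z, trivial, abs_of_nonneg hz⟩
      rw [this]; exact convex_Ici 0
    · rintro _ ⟨y, -, rfl⟩ _ ⟨z, -, rfl⟩ h
      exact Real.rpow_le_rpow (abs_nonneg y) h (by linarith)
  have hφcont : Continuous φ := continuous_abs.rpow_const fun _ => Or.inr (by linarith)
  have hφ0 : ∀ y, 0 ≤ φ y := fun y => Real.rpow_nonneg (abs_nonneg y) _
  have hφint : ∀ n, Integrable (φ ∘ M n) μ := by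
    intro n
    refine ⟨hφcont.comp_aestronglyMeasurable (hMint n).1, ?_⟩
    refine (hasFiniteIntegral_iff_ofReal (f := φ ∘ M n)
      (Filter.Eventually.of_forall fun ω => hφ0 _)).mpr ?_
    exact (hmom (n + 1) (by omega)).trans_lt ENNReal.ofReal_lt_top
  let f : ℕ → Ω → ℝ := fun n => φ ∘ M n
  have hsub : Submartingale f 𝒢 μ := by
    refine submartingale_nat (fun n => hφcont.comp_stronglyMeasurable (hMad n)) hφint fun i => ?_
    have h1 := hφc.map_condExp_le_of_finiteDimensional (𝒢.le i) (hMint (i + 1)) (hφint (i + 1))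
    filter_upwards [h1, hM.condExp_ae_eq (Nat.le_succ i)] with ω h2 h3
    simp only [Function.comp_apply] at h2
    rw [h3] at h2
    exact h2
  have hmax := maximal_ineq hsub (fun n ω => hφ0 _) (ε := ⟨x ^ r, by positivity⟩) n
  set E := {ω | x ^ r ≤ (Finset.range (n + 1)).sup' Finset.nonempty_range_add_one
    fun k => f k ω} with hE
  have hsubset : {ω | ∃ k, 1 ≤ k ∧ k ≤ n + 1 ∧ x ≤ ∑ i ∈ Finset.range k, X i ω} ⊆ E := by
    rintro ω ⟨k, hk1, hkn, hk⟩
    simp only [hE, Set.mem_ofPred_eq]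
    rw [Finset.le_sup'_iff]
    refine ⟨k - 1, by simp; omega, ?_⟩
    have : k - 1 + 1 = k := by omega
    simp only [f, M, φ, Function.comp_apply, this]
    exact Real.rpow_le_rpow hx.le (hk.trans (le_abs_self _)) (by linarith)
  refine (measure_mono hsubset).trans ?_
  have h2 : ENNReal.ofReal (x ^ r) * μ E ≤ ENNReal.ofReal (C * ((n + 1 : ℕ) : ℝ) ^ s) := by
    have h3 : ENNReal.ofReal (∫ ω in E, f n ω ∂μ) ≤ ENNReal.ofReal (C * ((n + 1 : ℕ) : ℝ) ^ s) := by
      refine le_trans ?_ (hmom (n + 1) (by omega))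
      refine le_trans ?_ (ofReal_integral_eq_lintegral_ofReal (hφint n)
        (Filter.Eventually.of_forall fun ω => hφ0 _)).le
      exact ENNReal.ofReal_le_ofReal (setIntegral_le_integral (hφint n)
        (Filter.Eventually.of_forall fun ω => hφ0 _))
    refine le_trans ?_ h3
    rw [ENNReal.ofReal_eq_coe_nnreal (show 0 ≤ x ^ r by positivity)]
    exact hmax
  have hxr : 0 < x ^ r := by positivity
  rw [ENNReal.ofReal_div_of_pos hxr, ENNReal.le_div_iff_mul_le, mul_comm]
  · exact h2
  · left; simpa using hxr
  · left; exact ENNReal.ofReal_ne_top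

lemma renewal_const (r s : ℝ) (hs : 1 < s) (hr : s < r) :
    2 ^ r * (1 - 2 ^ (-(r - s)))⁻¹ ≤
      (10 ^ 3 * (r + 1) ^ 2 / ((s - 1) * (r - s))) ^ (r + 1) := by
  have hd : 0 < r - s := by linarith
  set d := r - s with hdd
  have hs1 : 0 < s - 1 := by linarith
  set b := 10 ^ 3 * (r + 1) ^ 2 / ((s - 1) * d) with hb
  have hb1 : 2 * (r + 1) / d ≤ b := by
    rw [hb, div_le_div_iff₀ hd (by positivity)]
    nlinarith [mul_pos hd hd, mul_pos hd hs1, mul_pos (mul_pos hd hd) hs1, 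
      mul_pos hd (show 0 < r + 1 by linarith),
      mul_pos (mul_pos hd (show 0 < r + 1 by linarith)) hs1,
      mul_pos (mul_pos hd (show 0 < r + 1 by linarith)) (show 0 < r + 1 - (s - 1) by linarith)]
  have hb2 : 2 ≤ b := by
    refine le_trans ?_ hb1
    rw [le_div_iff₀ hd]; linarith
  rw [Real.rpow_add (by linarith), Real.rpow_one]
  refine mul_le_mul (Real.rpow_le_rpow (by norm_num) hb2 (by linarith)) ?_ ?_ (by positivity)
  · refine le_trans ?_ hb1
    have h2d : (2:ℝ) ^ (-d) * (1 + d / 2) ≤ 1 := by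
      have h1 : 1 + d / 2 ≤ (2:ℝ) ^ d := by
        rw [Real.rpow_def_of_pos (by norm_num)]
        have := Real.add_one_le_exp (Real.log 2 * d)
        nlinarith [Real.log_two_gt_d9]
      calc (2:ℝ) ^ (-d) * (1 + d / 2) ≤ 2 ^ (-d) * 2 ^ d := by gcongr
        _ = 1 := by rw [← Real.rpow_add (by norm_num)]; simp
    have h3 : d / (2 * (r + 1)) ≤ 1 - (2:ℝ) ^ (-d) := by
      have h4 : (2:ℝ) ^ (-d) ≤ 1 / (1 + d / 2) := by
        rw [le_div_iff₀ (by positivity)]; exact h2d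
      have h5 : d / (2 * (r + 1)) ≤ 1 - 1 / (1 + d / 2) := by
        have : 1 - 1 / (1 + d / 2) = d / (2 + d) := by field_simp; ring
        rw [this]
        apply div_le_div_of_nonneg_left hd.le (by linarith) (by linarith)
      linarith
    calc (1 - (2:ℝ) ^ (-d))⁻¹ ≤ (d / (2 * (r + 1)))⁻¹ := by
          apply inv_anti₀ _ h3
          have : 0 < r + 1 := by linarith
          positivity
      _ = _ := by rw [inv_div]
  · have : (2:ℝ) ^ (-d) ≤ 1 := Real.rpow_le_one_of_one_le_of_nonpos (by norm_num) (by linarith)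
    exact inv_nonneg.mpr (by linarith)

lemma renewal_union {Ω : Type*} [MeasurableSpace Ω] (μ : Measure Ω) [IsProbabilityMeasure μ]
    (D : ℕ → Ω → ℝ) (C s r : ℝ) (hC : 0 < C) (hs : 1 < s) (hr : s < r)
    (hmax : ∀ (n : ℕ) (x : ℝ), 0 < x → μ {ω | ∃ k, 1 ≤ k ∧ k ≤ n + 1 ∧ x ≤ D k ω} ≤
      ENNReal.ofReal (C * ((n + 1 : ℕ) : ℝ) ^ s / x ^ r))
    (a ν lam : ℝ) (ha : 0 < a) (hν : 0 < ν) (hlam : 0 < lam) :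
    μ {ω | ∃ k : ℕ, 1 ≤ k ∧ ν * k + a * lam ≤ (a + ν) * D k ω} ≤
      ENNReal.ofReal ((10 ^ 3 * (r + 1) ^ 2 / ((s - 1) * (r - s))) ^ (r + 1) * C * ν ^ (-s)
            * (a + ν) ^ r * a ^ (-(r - s)) * lam ^ (-(r - s))) := by
  set N := a * lam / ν with hN
  have hNpos : 0 < N := by positivity
  let B : ℕ → Set Ω := fun j => {ω | ∃ k : ℕ, 1 ≤ k ∧ (k : ℝ) ≤ 2 ^ j * N ∧
    a * lam * 2 ^ j / (2 * (a + ν)) ≤ D k ω}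
  have hcover : {ω | ∃ k : ℕ, 1 ≤ k ∧ ν * k + a * lam ≤ (a + ν) * D k ω} ⊆ ⋃ j, B j := by
    rintro ω ⟨k, hk1, hk⟩
    have hex : ∃ j : ℕ, (k : ℝ) ≤ 2 ^ j * N := by
      obtain ⟨j, hj⟩ := pow_unbounded_of_one_lt ((k : ℝ) / N) (one_lt_two)
      exact ⟨j, by rw [div_lt_iff₀ hNpos] at hj; exact hj.le⟩
    classical
    refine Set.mem_iUnion.mpr ⟨Nat.find hex, k, hk1, Nat.find_spec hex, ?_⟩
    rw [div_le_iff₀ (by positivity)]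
    rcases hj : Nat.find hex with _ | j
    · have : 0 ≤ ν * (k : ℝ) := by positivity
      have : 0 < a * lam := by positivity
      simp only [pow_zero]; linarith
    · have hlt := Nat.find_min hex (m := j) (by omega)
      push Not at hlt
      have h1 : ν * (2 ^ j * N) = 2 ^ j * (a * lam) := by rw [hN]; field_simp
      have h2 : ν * (2 ^ j * N) ≤ ν * k := by gcongr
      have : 0 < a * lam := by positivity
      rw [pow_succ]; linarith
  set Q := C * ν ^ (-s) * (a + ν) ^ r * a ^ (-(r - s)) * lam ^ (-(r - s)) with hQ
  have hQpos : 0 < Q := by positivity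
  set q : ℝ := 2 ^ (-(r - s)) with hq
  have hq0 : 0 < q := by positivity
  have hq1 : q < 1 := Real.rpow_lt_one_of_one_lt_of_neg (by norm_num) (by linarith)
  have hB : ∀ j, μ (B j) ≤ ENNReal.ofReal (2 ^ r * Q * q ^ j) := by
    intro j
    have hx : 0 < a * lam * 2 ^ j / (2 * (a + ν)) := by positivity
    by_cases hfl : ⌊2 ^ j * N⌋₊ = 0
    · have : B j = ∅ := by
        ext ω
        simp only [B, Set.mem_ofPred_eq, Set.mem_empty_iff_false, iff_false]
        rintro ⟨k, hk1, hk2, -⟩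
        have := Nat.le_floor hk2
        omega
      rw [this]; simp
    · obtain ⟨n, hn⟩ := Nat.exists_eq_succ_of_ne_zero hfl
      refine le_trans (measure_mono ?_) ((hmax n _ hx).trans (ENNReal.ofReal_le_ofReal ?_))
      · rintro ω ⟨k, hk1, hk2, hk3⟩
        refine ⟨k, hk1, ?_, hk3⟩
        have := Nat.le_floor hk2
        omega
      · have hle : ((n + 1 : ℕ) : ℝ) ≤ 2 ^ j * N := by
          have := Nat.floor_le (a := 2 ^ j * N) (by positivity)
          rw [hn] at this; exact this
        calc C * ((n + 1 : ℕ) : ℝ) ^ s / (a * lam * 2 ^ j / (2 * (a + ν))) ^ r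
            ≤ C * (2 ^ j * N) ^ s / (a * lam * 2 ^ j / (2 * (a + ν))) ^ r := by
              gcongr
          _ = 2 ^ r * Q * q ^ j := by
              have haν : 0 < a + ν := by positivity
              have hqj : q ^ j = ((2:ℝ) ^ j) ^ (-(r - s)) := by
                rw [hq, ← Real.rpow_natCast, ← Real.rpow_natCast, ← Real.rpow_mul (by norm_num),
                  ← Real.rpow_mul (by norm_num), mul_comm]
              rw [hqj, hQ, hN]
              have hp : (0:ℝ) < 2 ^ j := by positivity
              generalize (2:ℝ) ^ j = p at hp
              rw [Real.div_rpow (by positivity) (by positivity),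
                Real.mul_rpow (by positivity) (by positivity),
                Real.mul_rpow (by positivity) (by positivity),
                Real.mul_rpow (by positivity) (by positivity),
                Real.mul_rpow (by positivity) (by positivity),
                Real.div_rpow (by positivity) (by positivity),
                Real.mul_rpow (by positivity) (by positivity)]
              simp only [neg_sub]
              rw [Real.rpow_sub ha, Real.rpow_sub hlam, Real.rpow_sub hp, Real.rpow_neg hν.le]
              field_simp
  have hsum : Summable fun j : ℕ => 2 ^ r * Q * q ^ j :=
    (summable_geometric_of_lt_one hq0.le hq1).mul_left _
  calc _ ≤ μ (⋃ j, B j) := measure_mono hcover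
    _ ≤ ∑' j, μ (B j) := measure_iUnion_le _
    _ ≤ ∑' j, ENNReal.ofReal (2 ^ r * Q * q ^ j) := ENNReal.tsum_le_tsum hB
    _ = ENNReal.ofReal (∑' j, 2 ^ r * Q * q ^ j) :=
        (ENNReal.ofReal_tsum_of_nonneg (fun j => by positivity) hsum).symm
    _ ≤ _ := by
        refine ENNReal.ofReal_le_ofReal ?_
        rw [tsum_mul_left, tsum_geometric_of_lt_one hq0.le hq1]
        have := mul_le_mul_of_nonneg_right (renewal_const r s hs hr) hQpos.le
        rw [← hq] at this
        rw [hQ] at this ⊢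
        linarith

/-- Tail bound for the all-time supremum of the drift-adjusted ordinary renewal counting
process `A_o(t) - μ t - ν t`, given a central-moment bound on the normalized partial sums
of the i.i.d. renewal intervals. -/
theorem renewal_sup_tail_bound
    {Ω : Type*} [MeasurableSpace Ω] (μ : Measure Ω) [IsProbabilityMeasure μ]
    (A : ℕ → Ω → ℝ)
    (hAmeas : ∀ i, Measurable (A i))
    (hAnn : ∀ i, ∀ᵐ ω ∂μ, 0 ≤ A i ω)
    (hindep : iIndepFun A μ)
    (hlaw : ∀ i, μ.map (A i) = μ.map (A 0))
    (hint : Integrable (A 0) μ) (hEA : 0 < ∫ ω, A 0 ω ∂μ)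
    (μA : ℝ) (hμA : μA = (∫ ω, A 0 ω ∂μ)⁻¹)
    (C₃ s₃ r₃ : ℝ) (hC₃ : 0 < C₃) (hs₃ : 1 < s₃) (hr₃ : s₃ < r₃)
    (hmom : ∀ k : ℕ, 1 ≤ k →
      ∫⁻ ω, ENNReal.ofReal (|(k : ℝ) - μA * ∑ i ∈ Finset.range k, A i ω| ^ r₃) ∂μ
        ≤ ENNReal.ofReal (C₃ * (k : ℝ) ^ s₃)) :
    ∀ ν : ℝ, 0 < ν → ∀ lam : ℝ, 0 < lam →
      (μ {ω | (lam : EReal) ≤ ⨆ t : ℝ≥0,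
          (((renewalCount (fun i => A i ω) (t : ℝ) : ℝ) - μA * (t : ℝ) - ν * (t : ℝ) : ℝ) : EReal)}).toReal
        ≤ (10 ^ 3 * (r₃ + 1) ^ 2 / ((s₃ - 1) * (r₃ - s₃))) ^ (r₃ + 1) * C₃ * ν ^ (-s₃)
            * (μA + ν) ^ r₃ * μA ^ (-(r₃ - s₃)) * lam ^ (-(r₃ - s₃)) := by
  intro ν hν lam hlam
  have hμApos : 0 < μA := by rw [hμA]; exact inv_pos.mpr hEA
  set X : ℕ → Ω → ℝ := fun i ω => 1 - μA * A i ω with hX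
  have hid : ∀ i, IdentDistrib (A i) (A 0) μ μ := fun i =>
    ⟨(hAmeas i).aemeasurable, (hAmeas 0).aemeasurable, hlaw i⟩
  have hAint : ∀ i, Integrable (A i) μ := fun i => (hid i).integrable_iff.mpr hint
  have hXm : ∀ i, Measurable (X i) := fun i => ((hAmeas i).const_mul μA).const_sub 1
  have hXind : iIndepFun X μ :=
    hindep.comp (fun _ y => 1 - μA * y) fun _ => (measurable_id.const_mul μA).const_sub 1
  have hXint : ∀ i, Integrable (X i) μ := fun i =>
    (integrable_const 1).sub ((hAint i).const_mul μA)
  have hXmean : ∀ i, ∫ ω, X i ω ∂μ = 0 := by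
    intro i
    simp only [hX]
    rw [integral_sub (integrable_const 1) ((hAint i).const_mul μA), integral_const_mul,
      (hid i).integral_eq, hμA, inv_mul_cancel₀ hEA.ne']
    simp
  have hsumX : ∀ k ω, ∑ i ∈ Finset.range k, X i ω = k - μA * ∑ i ∈ Finset.range k, A i ω := by
    intro k ω
    simp [hX, Finset.sum_sub_distrib, Finset.mul_sum]
  have hmax := renewal_maximal μ X hXm hXind hXint hXmean C₃ s₃ r₃ hC₃ (by linarith)
    (by intro k hk; simp only [hsumX]; exact hmom k hk)
  have hun := fun l hl => renewal_union μ (fun k ω => ∑ i ∈ Finset.range k, X i ω) C₃ s₃ r₃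
    hC₃ hs₃ hr₃ hmax μA ν l hμApos hν hl
  have hKnn : ∀ l : ℝ, 0 < l → 0 ≤ (10 ^ 3 * (r₃ + 1) ^ 2 / ((s₃ - 1) * (r₃ - s₃))) ^ (r₃ + 1)
      * C₃ * ν ^ (-s₃) * (μA + ν) ^ r₃ * μA ^ (-(r₃ - s₃)) * l ^ (-(r₃ - s₃)) := by
    intro l hl
    have h1 : 0 < s₃ - 1 := by linarith
    have h2 : 0 < r₃ - s₃ := by linarith
    have h3 : 0 < r₃ + 1 := by linarith
    positivity
  set S := {ω | (lam : EReal) ≤ ⨆ t : ℝ≥0,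
          (((renewalCount (fun i => A i ω) (t : ℝ) : ℝ) - μA * (t : ℝ) - ν * (t : ℝ) : ℝ) : EReal)}
    with hS
  have hbound : ∀ l : ℝ, l ∈ Set.Ioo 0 lam → (μ S).toReal ≤
      (10 ^ 3 * (r₃ + 1) ^ 2 / ((s₃ - 1) * (r₃ - s₃))) ^ (r₃ + 1)
      * C₃ * ν ^ (-s₃) * (μA + ν) ^ r₃ * μA ^ (-(r₃ - s₃)) * l ^ (-(r₃ - s₃)) := by
    rintro l ⟨hl, hllam⟩
    refine ENNReal.toReal_le_of_le_ofReal (hKnn l hl) ((measure_mono ?_).trans (hun l hl))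
    intro ω hω
    have hlt : (l : EReal) < ⨆ t : ℝ≥0,
          (((renewalCount (fun i => A i ω) (t : ℝ) : ℝ) - μA * (t : ℝ) - ν * (t : ℝ) : ℝ) : EReal) :=
      lt_of_lt_of_le (EReal.coe_lt_coe_iff.mpr hllam) hω
    obtain ⟨t, ht⟩ := lt_iSup_iff.mp hlt
    rw [EReal.coe_lt_coe_iff] at ht
    have ht0 : (0:ℝ) ≤ t := t.2
    set k := renewalCount (fun i => A i ω) (t : ℝ) with hk
    have hk1 : 1 ≤ k := by
      by_contra hcon
      have h0 : k = 0 := by omega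
      rw [h0] at ht
      have : 0 ≤ μA * (t : ℝ) := by positivity
      have : 0 ≤ ν * (t : ℝ) := by positivity
      simp at ht
      linarith
    have hmem : ∑ i ∈ Finset.range k, A i ω ≤ t := by
      have hne : {n : ℕ | ∑ i ∈ Finset.range n, A i ω ≤ t}.Nonempty := ⟨0, by simp⟩
      by_cases hb : BddAbove {n : ℕ | ∑ i ∈ Finset.range n, A i ω ≤ t}
      · exact Nat.sSup_mem hne hb
      · exfalso
        have : k = 0 := by
          rw [hk]; unfold renewalCount; exact Nat.sSup_of_not_bddAbove hb
        omega
    refine ⟨k, hk1, ?_⟩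
    simp only [hsumX]
    have h1 := mul_le_mul_of_nonneg_left hmem (show 0 ≤ μA * (μA + ν) by positivity)
    have h2 := mul_lt_mul_of_pos_left ht hμApos
    nlinarith
  have hcont : Filter.Tendsto (fun l : ℝ =>
      (10 ^ 3 * (r₃ + 1) ^ 2 / ((s₃ - 1) * (r₃ - s₃))) ^ (r₃ + 1)
      * C₃ * ν ^ (-s₃) * (μA + ν) ^ r₃ * μA ^ (-(r₃ - s₃)) * l ^ (-(r₃ - s₃)))
      (nhdsWithin lam (Set.Iio lam)) (nhds
      ((10 ^ 3 * (r₃ + 1) ^ 2 / ((s₃ - 1) * (r₃ - s₃))) ^ (r₃ + 1)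
      * C₃ * ν ^ (-s₃) * (μA + ν) ^ r₃ * μA ^ (-(r₃ - s₃)) * lam ^ (-(r₃ - s₃)))) :=
    ((Real.continuousAt_rpow_const lam _ (Or.inl hlam.ne')).const_mul _).tendsto.mono_left
      nhdsWithin_le_nhds
  refine ge_of_tendsto hcont ?_
  filter_upwards [Ioo_mem_nhdsLT hlam] with l hl
  exact hbound l hl
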